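/- arXiv:1909.06279 — 3 statements merged into one kernel-verified Lean document; each statement's English description precedes it below -/
import Mathlib

section
/- Let $m, n \in \mathbb{N}$, let $X$ be a real $m \times n$ matrix, let $y \in \mathbb{R}^m$, and let $\lambda_1 \ge 0$, $\lambda_2 \ge 0$. Then a vector $\hat\beta \in \mathbb{R}^n$ minimizes the elastic net objective $\beta \mapsto \beta^T \frac{X^T X + \lambda_2 I}{1+\lambda_2} \beta - 2 y^T X \beta + \lambda_1 \|\beta\|_1$ over $\mathbb{R}^n$ if and only if $\hat\beta/(1+\lambda_2)$ minimizes the naive elastic net criterion $\beta \mapsto \|y - X\beta\|_2^2 + \lambda_1 \|\beta\|_1 + \lambda_2 \|\beta\|_2^2$ over $\mathbb{R}^n$. -/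
open Matrix Finset

theorem elastic_key (m n : ℕ) (X : Matrix (Fin m) (Fin n) ℝ)
    (y : Fin m → ℝ) (lam1 lam2 : ℝ) (hlam2 : 0 ≤ lam2) (γ : Fin n → ℝ) :
    ((1 + lam2) • γ) ⬝ᵥ (((1 + lam2)⁻¹ •
        (Xᵀ * X + lam2 • (1 : Matrix (Fin n) (Fin n) ℝ))).mulVec ((1 + lam2) • γ))
            - 2 * (y ⬝ᵥ X.mulVec ((1 + lam2) • γ)) + lam1 * (∑ j, |((1 + lam2) • γ) j|)
      = (1 + lam2) * ((∑ i, (y i - X.mulVec γ i) ^ 2)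
            + lam1 * (∑ j, |γ j|) + lam2 * (∑ j, (γ j) ^ 2) - ∑ i, y i ^ 2) := by
  have hc : 0 < 1 + lam2 := by linarith
  have h1 : ∑ j, |((1 + lam2) • γ) j| = (1 + lam2) * ∑ j, |γ j| := by
    simp [Finset.mul_sum, abs_mul, abs_of_pos hc]
  have h2 : ∑ i, (y i - X.mulVec γ i) ^ 2
      = ∑ i, y i ^ 2 - 2 * (y ⬝ᵥ X.mulVec γ) + X.mulVec γ ⬝ᵥ X.mulVec γ := by
    simp only [dotProduct, Finset.mul_sum, ← Finset.sum_sub_distrib, ← Finset.sum_add_distrib]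
    exact Finset.sum_congr rfl fun i _ => by ring
  have h3 : ∑ j, (γ j) ^ 2 = γ ⬝ᵥ γ := by
    simp only [dotProduct, sq]
  have h4 : γ ⬝ᵥ (Xᵀ * X).mulVec γ = X.mulVec γ ⬝ᵥ X.mulVec γ := by
    rw [← Matrix.mulVec_mulVec, Matrix.dotProduct_mulVec, Matrix.vecMul_transpose]
  rw [h1, h2, h3]
  simp only [Matrix.mulVec_smul, Matrix.smul_mulVec, Matrix.add_mulVec, Matrix.one_mulVec,
    dotProduct_smul, smul_dotProduct, dotProduct_add, smul_eq_mul, h4]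
  field_simp
  ring

/-- `β̂` minimizes the elastic net objective
`β ↦ βᵀ ((XᵀX + λ₂ I)/(1+λ₂)) β - 2 yᵀXβ + λ₁‖β‖₁` over `ℝⁿ` if and only if
`β̂/(1+λ₂)` minimizes the naive elastic net criterion
`β ↦ ‖y - Xβ‖₂² + λ₁‖β‖₁ + λ₂‖β‖₂²` over `ℝⁿ`. -/
theorem elastic_net_minimizer_iff (m n : ℕ) (X : Matrix (Fin m) (Fin n) ℝ)
    (y : Fin m → ℝ) (lam1 lam2 : ℝ) (hlam1 : 0 ≤ lam1) (hlam2 : 0 ≤ lam2)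
    (βhat : Fin n → ℝ) :
    (∀ β : Fin n → ℝ,
        βhat ⬝ᵥ (((1 + lam2)⁻¹ • (Xᵀ * X + lam2 • (1 : Matrix (Fin n) (Fin n) ℝ))).mulVec βhat)
            - 2 * (y ⬝ᵥ X.mulVec βhat) + lam1 * (∑ j, |βhat j|)
          ≤ β ⬝ᵥ (((1 + lam2)⁻¹ • (Xᵀ * X + lam2 • (1 : Matrix (Fin n) (Fin n) ℝ))).mulVec β)
            - 2 * (y ⬝ᵥ X.mulVec β) + lam1 * (∑ j, |β j|))
      ↔
    (∀ β : Fin n → ℝ,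
        (∑ i, (y i - X.mulVec ((1 + lam2)⁻¹ • βhat) i) ^ 2)
            + lam1 * (∑ j, |((1 + lam2)⁻¹ • βhat) j|)
            + lam2 * (∑ j, (((1 + lam2)⁻¹ • βhat) j) ^ 2)
          ≤ (∑ i, (y i - X.mulVec β i) ^ 2)
            + lam1 * (∑ j, |β j|) + lam2 * (∑ j, (β j) ^ 2)) := by
  have hc : 0 < 1 + lam2 := by linarith
  have hb : βhat = (1 + lam2) • ((1 + lam2)⁻¹ • βhat) := (smul_inv_smul₀ hc.ne' βhat).symm
  generalize (1 + lam2)⁻¹ • βhat = γ at hb ⊢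
  subst hb
  constructor
  · intro h β
    have h' := h ((1 + lam2) • β)
    rw [elastic_key m n X y lam1 lam2 hlam2, elastic_key m n X y lam1 lam2 hlam2] at h'
    have := le_of_mul_le_mul_left h' hc
    linarith
  · intro h β
    have hb : β = (1 + lam2) • ((1 + lam2)⁻¹ • β) := (smul_inv_smul₀ hc.ne' β).symm
    rw [hb, elastic_key m n X y lam1 lam2 hlam2, elastic_key m n X y lam1 lam2 hlam2]
    have := h ((1 + lam2)⁻¹ • β)
    exact mul_le_mul_of_nonneg_left (by linarith) hc.le
end

section
/- Let $m, n \in \mathbb{N}$, let $X$ be a real $m \times n$ matrix, let $y \in \mathbb{R}^m$, and let $\lambda_1 \ge 0$, $\lambda_2 \ge 0$. Define the augmented $(m+n) \times n$ matrix $X^* = (1+\lambda_2)^{-1/2} \begin{pmatrix} X \\ \sqrt{\lambda_2}\, I_n \end{pmatrix}$, the augmented vector $y^* = \begin{pmatrix} y \\ 0 \end{pmatrix} \in \mathbb{R}^{m+n}$, and $\gamma = \lambda_1/\sqrt{1+\lambda_2}$. Then for every $\beta \in \mathbb{R}^n$, setting $\beta^* = \sqrt{1+\lambda_2}\,\beta$,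 we have the identity $\|y^* - X^* \beta^*\|_2^2 + \gamma \|\beta^*\|_1 = \|y - X\beta\|_2^2 + \lambda_1 \|\beta\|_1 + \lambda_2 \|\beta\|_2^2$. -/
open Matrix Finset

/-- With augmented data `X* = (1+λ₂)^{-1/2} (X; √λ₂ I)`, `y* = (y; 0)` and
`γ = λ₁/√(1+λ₂)`, setting `β* = √(1+λ₂) β`, the LASSO objective on the
augmented data equals the naive elastic net criterion:
`‖y* - X*β*‖₂² + γ‖β*‖₁ = ‖y - Xβ‖₂² + λ₁‖β‖₁ + λ₂‖β‖₂²`. -/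
theorem elastic_net_augmented_identity (m n : ℕ) (X : Matrix (Fin m) (Fin n) ℝ)
    (y : Fin m → ℝ) (lam1 lam2 : ℝ) (hlam1 : 0 ≤ lam1) (hlam2 : 0 ≤ lam2)
    (Xstar : Matrix (Fin m ⊕ Fin n) (Fin n) ℝ)
    (hXstar : Xstar = (Real.sqrt (1 + lam2))⁻¹ •
      Matrix.fromRows X (Real.sqrt lam2 • (1 : Matrix (Fin n) (Fin n) ℝ)))
    (ystar : Fin m ⊕ Fin n → ℝ) (hystar : ystar = Sum.elim y 0)
    (γ : ℝ) (hγ : γ = lam1 / Real.sqrt (1 + lam2))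
    (β : Fin n → ℝ) (βstar : Fin n → ℝ) (hβstar : βstar = Real.sqrt (1 + lam2) • β) :
    (∑ i, (ystar i - Xstar.mulVec βstar i) ^ 2) + γ * (∑ j, |βstar j|)
      = (∑ i, (y i - X.mulVec β i) ^ 2) + lam1 * (∑ j, |β j|)
        + lam2 * (∑ j, (β j) ^ 2) := by
  have hs : 0 < Real.sqrt (1 + lam2) := Real.sqrt_pos.mpr (by linarith)
  have hX : Xstar.mulVec βstar = Sum.elim (X.mulVec β) (Real.sqrt lam2 • β) := by
    rw [hXstar, hβstar, Matrix.smul_mulVec, Matrix.mulVec_smul, smul_smul,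
      inv_mul_cancel₀ hs.ne', one_smul, Matrix.fromRows_mulVec, Matrix.smul_mulVec,
      Matrix.one_mulVec]
  have h1 : γ * (∑ j, |βstar j|) = lam1 * (∑ j, |β j|) := by
    have h2 : ∑ j, |βstar j| = Real.sqrt (1 + lam2) * ∑ j, |β j| := by
      rw [hβstar, Finset.mul_sum]
      refine Finset.sum_congr rfl fun j _ => ?_
      rw [Pi.smul_apply, smul_eq_mul, abs_mul, abs_of_pos hs]
    rw [h2, hγ, ← mul_assoc, div_mul_cancel₀ _ hs.ne']
  have h3 : ∑ j, (0 - Real.sqrt lam2 * β j) ^ 2 = lam2 * ∑ j, (β j) ^ 2 := by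
    rw [Finset.mul_sum]
    refine Finset.sum_congr rfl fun j _ => ?_
    rw [zero_sub, neg_sq, mul_pow, Real.sq_sqrt hlam2]
  rw [h1, hX, hystar, Fintype.sum_sum_type]
  simp only [Sum.elim_inl, Sum.elim_inr, Pi.zero_apply, Pi.smul_apply, smul_eq_mul]
  rw [h3]
  ring
end

section
/- Let $m, n \in \mathbb{N}$, let $X$ be a real $m \times n$ matrix, let $y \in \mathbb{R}^m$, and let $\lambda_1 \ge 0$, $\lambda_2 \ge 0$. With $X^* = (1+\lambda_2)^{-1/2} \begin{pmatrix} X \\ \sqrt{\lambda_2}\, I_n \end{pmatrix}$, $y^* = \begin{pmatrix} y \\ 0 \end{pmatrix}$, and $\gamma = \lambda_1/\sqrt{1+\lambda_2}$: a vector $\hat\beta^* \in \mathbb{R}^n$ minimizes the LASSO objective $\beta^* \mapsto \|y^* - X^* \beta^*\|_2^2 + \gamma\|\beta^*\|_1$ over $\mathbb{R}^n$ if and only if $\hat\beta^*/\sqrt{1+\lambda_2}$ minimizes the naive elastic net criterion $\beta \mapsto \|y - X\beta\|_2^2 + \lambda_1\|\beta\|_1 + \lambda_2\|\beta\|_2^2$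 over $\mathbb{R}^n$. -/
open Matrix Finset

/-- With augmented data `X* = (1+λ₂)^{-1/2} (X; √λ₂ I)`, `y* = (y; 0)` and
`γ = λ₁/√(1+λ₂)`: `β̂*` minimizes the LASSO objective
`β* ↦ ‖y* - X*β*‖₂² + γ‖β*‖₁` over `ℝⁿ` iff `β̂*/√(1+λ₂)` minimizes the naive
elastic net criterion `β ↦ ‖y - Xβ‖₂² + λ₁‖β‖₁ + λ₂‖β‖₂²` over `ℝⁿ`. -/
theorem lasso_augmented_iff_elastic_net (m n : ℕ) (X : Matrix (Fin m) (Fin n) ℝ)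
    (y : Fin m → ℝ) (lam1 lam2 : ℝ) (hlam1 : 0 ≤ lam1) (hlam2 : 0 ≤ lam2)
    (Xstar : Matrix (Fin m ⊕ Fin n) (Fin n) ℝ)
    (hXstar : Xstar = (Real.sqrt (1 + lam2))⁻¹ •
      Matrix.fromRows X (Real.sqrt lam2 • (1 : Matrix (Fin n) (Fin n) ℝ)))
    (ystar : Fin m ⊕ Fin n → ℝ) (hystar : ystar = Sum.elim y 0)
    (γ : ℝ) (hγ : γ = lam1 / Real.sqrt (1 + lam2))
    (βhatstar : Fin n → ℝ) :
    (∀ βstar : Fin n → ℝ,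
        (∑ i, (ystar i - Xstar.mulVec βhatstar i) ^ 2) + γ * (∑ j, |βhatstar j|)
          ≤ (∑ i, (ystar i - Xstar.mulVec βstar i) ^ 2) + γ * (∑ j, |βstar j|))
      ↔
    (∀ β : Fin n → ℝ,
        (∑ i, (y i - X.mulVec ((Real.sqrt (1 + lam2))⁻¹ • βhatstar) i) ^ 2)
            + lam1 * (∑ j, |((Real.sqrt (1 + lam2))⁻¹ • βhatstar) j|)
            + lam2 * (∑ j, (((Real.sqrt (1 + lam2))⁻¹ • βhatstar) j) ^ 2)
          ≤ (∑ i, (y i - X.mulVec β i) ^ 2)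
            + lam1 * (∑ j, |β j|) + lam2 * (∑ j, (β j) ^ 2)) := by
  have hs : 0 < Real.sqrt (1 + lam2) := Real.sqrt_pos.mpr (by linarith)
  have hne : Real.sqrt (1 + lam2) ≠ 0 := hs.ne'
  have key : ∀ b : Fin n → ℝ,
      (∑ i, (ystar i - Xstar.mulVec b i) ^ 2) + γ * (∑ j, |b j|)
        = (∑ i, (y i - X.mulVec ((Real.sqrt (1 + lam2))⁻¹ • b) i) ^ 2)
            + lam1 * (∑ j, |((Real.sqrt (1 + lam2))⁻¹ • b) j|)
            + lam2 * (∑ j, (((Real.sqrt (1 + lam2))⁻¹ • b) j) ^ 2) := by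
    intro b
    have h1 : ∀ i, Xstar.mulVec b (Sum.inl i)
        = X.mulVec ((Real.sqrt (1 + lam2))⁻¹ • b) i := by
      intro i
      rw [hXstar, Matrix.smul_mulVec, Matrix.fromRows_mulVec, Matrix.mulVec_smul]
      rfl
    have h2 : ∀ j, Xstar.mulVec b (Sum.inr j)
        = Real.sqrt lam2 * ((Real.sqrt (1 + lam2))⁻¹ • b) j := by
      intro j
      rw [hXstar, Matrix.smul_mulVec, Matrix.fromRows_mulVec, Matrix.smul_mulVec,
        Matrix.one_mulVec]
      simp only [Pi.smul_apply, Sum.elim_inr, smul_eq_mul]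
      ring
    have h3 : γ * (∑ j, |b j|)
        = lam1 * (∑ j, |((Real.sqrt (1 + lam2))⁻¹ • b) j|) := by
      simp only [Pi.smul_apply, smul_eq_mul, abs_mul, abs_of_pos (inv_pos.mpr hs)]
      rw [← Finset.mul_sum, hγ]
      ring
    have h4 : ∑ j, (0 - Real.sqrt lam2 * ((Real.sqrt (1 + lam2))⁻¹ • b) j) ^ 2
        = lam2 * (∑ j, (((Real.sqrt (1 + lam2))⁻¹ • b) j) ^ 2) := by
      rw [Finset.mul_sum]
      refine Finset.sum_congr rfl fun j _ => ?_
      rw [zero_sub, neg_sq, mul_pow, Real.sq_sqrt hlam2]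
    rw [Fintype.sum_sum_type, h3, ← h4]
    simp only [h1, h2, hystar, Sum.elim_inl, Sum.elim_inr, Pi.zero_apply]
    ring
  constructor
  · intro h β
    have h' := h (Real.sqrt (1 + lam2) • β)
    rw [key, key, inv_smul_smul₀ hne] at h'
    exact h'
  · intro h b
    rw [key, key]
    exact h _
end
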